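/- arXiv:0902.2722 — 3 statements merged into one kernel-verified Lean document; each statement's English description precedes it below -/
import Mathlib

section
/- For all octonions x, y, z ∈ 𝕆, the associator [x,y,z] = (xy)z − x(yz) is purely imaginary, i.e. Re((xy)z − x(yz)) = 0. -/
noncomputable section

/-- The octonions, as the Cayley–Dickson double of the quaternions. -/
def Octonion : Type := Quaternion ℝ × Quaternion ℝ

namespace Octonion

instance : AddCommGroup Octonion :=
  inferInstanceAs (AddCommGroup (Quaternion ℝ × Quaternion ℝ))

instance : Module ℝ Octonion :=
  inferInstanceAs (Module ℝ (Quaternion ℝ × Quaternion ℝ))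

/-- Cayley–Dickson multiplication: (a,b)·(c,d) = (a c − conj(d) b, d a + b conj(c)). -/
instance : Mul Octonion :=
  ⟨fun x y => (x.1 * y.1 - star y.2 * x.2, y.2 * x.1 + x.2 * star y.1)⟩

instance : One Octonion := ⟨((1 : Quaternion ℝ), 0)⟩

/-- Octonionic conjugation: conj (a,b) = (conj a, −b). -/
def conj (x : Octonion) : Octonion := (star x.1, -x.2)

/-- Real part of an octonion. -/
def re (x : Octonion) : ℝ := x.1.re

/-- Imaginary part of an octonion. -/
def im (x : Octonion) : Octonion := x - re x • 1

/-- Embedding of the reals into the octonions. -/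
def ofReal (r : ℝ) : Octonion := (((r : ℝ) : Quaternion ℝ), 0)

/-- The squared norm |w|² (the real scalar such that w · conj w = |w|² · 1). -/
def normSq (x : Octonion) : ℝ := Quaternion.normSq x.1 + Quaternion.normSq x.2

/-- The imaginary unit i. -/
def i : Octonion := ((⟨0, 1, 0, 0⟩ : Quaternion ℝ), 0)

/-- The imaginary unit j. -/
def j : Octonion := ((⟨0, 0, 1, 0⟩ : Quaternion ℝ), 0)

/-- The imaginary unit k. -/
def k : Octonion := ((⟨0, 0, 0, 1⟩ : Quaternion ℝ), 0)

/-- The imaginary unit ℓ. -/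
def l : Octonion := ((0 : Quaternion ℝ), (1 : Quaternion ℝ))

/-- The associator [x,y,z] = (xy)z − x(yz). -/
def assoc (x y z : Octonion) : Octonion := x * y * z - x * (y * z)

/-- A Jordan matrix: a 3×3 Hermitian matrix over the octonions. -/
def IsHermitian (A : Matrix (Fin 3) (Fin 3) Octonion) : Prop :=
  ∀ p q : Fin 3, conj (A q p) = A p q

/-- The right eigenvalue equation `A v = v λ`, componentwise. -/
def Eig (A : Matrix (Fin 3) (Fin 3) Octonion) (v : Fin 3 → Octonion) (lam : Octonion) : Prop :=
  ∀ p : Fin 3, A p 0 * v 0 + A p 1 * v 1 + A p 2 * v 2 = v p * lam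

end Octonion

namespace Octonion

theorem mul_fst (x y : Octonion) : (x * y).1 = x.1 * y.1 - star y.2 * x.2 := rfl

theorem mul_snd (x y : Octonion) : (x * y).2 = y.2 * x.1 + x.2 * star y.1 := rfl

theorem re_sub (x y : Octonion) : re (x - y) = re x - re y := rfl

end Octonion

open Octonion in
/-- The associator of any three octonions is purely imaginary. -/
theorem re_assoc_eq_zero (x y z : Octonion) : re (assoc x y z) = 0 := by
  rw [assoc, re_sub, sub_eq_zero]
  simp only [re, mul_fst, mul_snd, Quaternion.re_sub, Quaternion.re_add, Quaternion.re_mul,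
    Quaternion.imI_sub, Quaternion.imJ_sub, Quaternion.imK_sub,
    Quaternion.imI_add, Quaternion.imJ_add, Quaternion.imK_add,
    Quaternion.imI_mul, Quaternion.imJ_mul, Quaternion.imK_mul,
    Quaternion.re_star, Quaternion.imI_star, Quaternion.imJ_star, Quaternion.imK_star]
  ring
end
end

section
/- Let (x,y,z) be a generic triple of octonions, i.e. x = x₁ + x₂ i, y = y₁ + y₂ i + y₃ j, z = z₁ + z₂ i + z₃ j + z₄ k + z₈ ℓ with real coefficients and x₂ y₃ z₈ ≠ 0 (so that [x,y,z] ≠ 0). Set v = (x,y,z)ᵀ and λ = [x,y,z]. If A = !![p, a, conj c; conj a, m, b; c, conj b, n] is a Jordan matrix satisfying A v = v λ, and b = b₁ + b₂ i + b₃ j + b₄ k + b₅ kℓ + b₆ jℓ + b₇ iℓ + b₈ ℓ, then x₂ y₃ b₈ = 2 y₃ z₂ z₈ x₂² + b₆ y₁ x₂ − b₆ x₁ y₂ + b₇ x₁ y₃. -/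
noncomputable section

namespace Octonion

/-- The first quaternion component of an octonion. -/
def fst (u : Octonion) : Quaternion ℝ := u.1

/-- The second quaternion component of an octonion. -/
def snd (u : Octonion) : Quaternion ℝ := u.2

/-- The octonion `(e₀ + e₁ i + e₂ j + e₃ k, e₄ + e₅ i + e₆ j + e₇ k)`. -/
def ofCoords (e₀ e₁ e₂ e₃ e₄ e₅ e₆ e₇ : ℝ) : Octonion :=
  ((⟨e₀, e₁, e₂, e₃⟩ : Quaternion ℝ), (⟨e₄, e₅, e₆, e₇⟩ : Quaternion ℝ))

section Components

variable (u v : Octonion) (r : ℝ)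

@[simp] lemma fst_add : (u + v).fst = u.fst + v.fst := rfl
@[simp] lemma snd_add : (u + v).snd = u.snd + v.snd := rfl
@[simp] lemma fst_sub : (u - v).fst = u.fst - v.fst := rfl
@[simp] lemma snd_sub : (u - v).snd = u.snd - v.snd := rfl
@[simp] lemma fst_smul : (r • u).fst = r • u.fst := rfl
@[simp] lemma snd_smul : (r • u).snd = r • u.snd := rfl
@[simp] lemma fst_mul : (u * v).fst = u.fst * v.fst - star v.snd * u.snd := rfl
@[simp] lemma snd_mul : (u * v).snd = v.snd * u.fst + u.snd * star v.fst := rfl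
@[simp] lemma fst_conj : u.conj.fst = star u.fst := rfl
@[simp] lemma snd_conj : u.conj.snd = -u.snd := rfl
@[simp] lemma fst_ofReal : (ofReal r).fst = (r : Quaternion ℝ) := rfl
@[simp] lemma snd_ofReal : (ofReal r).snd = 0 := rfl

variable (e₀ e₁ e₂ e₃ e₄ e₅ e₆ e₇ : ℝ)

@[simp] lemma re_fst_ofCoords : (ofCoords e₀ e₁ e₂ e₃ e₄ e₅ e₆ e₇).fst.re = e₀ := rfl
@[simp] lemma imI_fst_ofCoords : (ofCoords e₀ e₁ e₂ e₃ e₄ e₅ e₆ e₇).fst.imI = e₁ := rfl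
@[simp] lemma imJ_fst_ofCoords : (ofCoords e₀ e₁ e₂ e₃ e₄ e₅ e₆ e₇).fst.imJ = e₂ := rfl
@[simp] lemma imK_fst_ofCoords : (ofCoords e₀ e₁ e₂ e₃ e₄ e₅ e₆ e₇).fst.imK = e₃ := rfl
@[simp] lemma re_snd_ofCoords : (ofCoords e₀ e₁ e₂ e₃ e₄ e₅ e₆ e₇).snd.re = e₄ := rfl
@[simp] lemma imI_snd_ofCoords : (ofCoords e₀ e₁ e₂ e₃ e₄ e₅ e₆ e₇).snd.imI = e₅ := rfl
@[simp] lemma imJ_snd_ofCoords : (ofCoords e₀ e₁ e₂ e₃ e₄ e₅ e₆ e₇).snd.imJ = e₆ := rfl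
@[simp] lemma imK_snd_ofCoords : (ofCoords e₀ e₁ e₂ e₃ e₄ e₅ e₆ e₇).snd.imK = e₇ := rfl

/-- Two octonions agree iff their eight real coordinates do. -/
lemma ext_coord_iff : u = v ↔
    (u.fst.re = v.fst.re ∧ u.fst.imI = v.fst.imI ∧ u.fst.imJ = v.fst.imJ ∧
      u.fst.imK = v.fst.imK) ∧
    u.snd.re = v.snd.re ∧ u.snd.imI = v.snd.imI ∧ u.snd.imJ = v.snd.imJ ∧
      u.snd.imK = v.snd.imK :=
  Prod.ext_iff.trans (and_congr Quaternion.ext_iff Quaternion.ext_iff)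

lemma exists_eq_ofCoords :
    ∃ e₀ e₁ e₂ e₃ e₄ e₅ e₆ e₇ : ℝ, u = ofCoords e₀ e₁ e₂ e₃ e₄ e₅ e₆ e₇ :=
  ⟨_, _, _, _, _, _, _, _, rfl⟩

end Components

lemma one_eq : 1 = ofCoords 1 0 0 0 0 0 0 0 := rfl
lemma i_eq : i = ofCoords 0 1 0 0 0 0 0 0 := rfl
lemma j_eq : j = ofCoords 0 0 1 0 0 0 0 0 := rfl
lemma k_eq : k = ofCoords 0 0 0 1 0 0 0 0 := rfl
lemma l_eq : l = ofCoords 0 0 0 0 1 0 0 0 := rfl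

lemma generic_fst_eq (x₁ x₂ : ℝ) :
    x₁ • (1 : Octonion) + x₂ • i = ofCoords x₁ x₂ 0 0 0 0 0 0 := by
  simp [ext_coord_iff, one_eq, i_eq]

lemma generic_snd_eq (y₁ y₂ y₃ : ℝ) :
    y₁ • (1 : Octonion) + y₂ • i + y₃ • j = ofCoords y₁ y₂ y₃ 0 0 0 0 0 := by
  simp [ext_coord_iff, one_eq, i_eq, j_eq]

lemma generic_trd_eq (z₁ z₂ z₃ z₄ z₈ : ℝ) :
    z₁ • (1 : Octonion) + z₂ • i + z₃ • j + z₄ • k + z₈ • l = ofCoords z₁ z₂ z₃ z₄ z₈ 0 0 0 := by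
  simp [ext_coord_iff, one_eq, i_eq, j_eq, k_eq, l_eq]

lemma basis_expansion_eq (b₁ b₂ b₃ b₄ b₅ b₆ b₇ b₈ : ℝ) :
    b₁ • (1 : Octonion) + b₂ • i + b₃ • j + b₄ • k + b₅ • (k * l) + b₆ • (j * l) +
      b₇ • (i * l) + b₈ • l = ofCoords b₁ b₂ b₃ b₄ b₈ b₇ b₆ b₅ := by
  simp [ext_coord_iff, one_eq, i_eq, j_eq, k_eq, l_eq]

/-- The associator of a generic triple is `2 x₂ y₃ z₈ kℓ`. -/
lemma assoc_generic (x₁ x₂ y₁ y₂ y₃ z₁ z₂ z₃ z₄ z₈ : ℝ) :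
    assoc (ofCoords x₁ x₂ 0 0 0 0 0 0) (ofCoords y₁ y₂ y₃ 0 0 0 0 0)
        (ofCoords z₁ z₂ z₃ z₄ z₈ 0 0 0) =
      ofCoords 0 0 0 0 0 0 0 (2 * x₂ * y₃ * z₈) := by
  simp only [ext_coord_iff, assoc]
  simp
  refine ⟨⟨?_, ?_, ?_, ?_⟩, ?_, ?_, ?_, ?_⟩ <;> ring

end Octonion

open Octonion in
/-- For a generic triple with nonzero associator, if the Jordan matrix
`!![p, a, conj c; conj a, m, b; c, conj b, n]` admits `v = (x,y,z)ᵀ` as an eigenvector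
with eigenvalue `λ = [x,y,z]`, then the `ℓ`-component of `b` satisfies
`x₂ y₃ b₈ = 2 y₃ z₂ z₈ x₂² + b₆ y₁ x₂ − b₆ x₁ y₂ + b₇ x₁ y₃`. -/
theorem b8_formula (x y z : Octonion) (x₁ x₂ y₁ y₂ y₃ z₁ z₂ z₃ z₄ z₈ : ℝ)
    (hx : x = x₁ • 1 + x₂ • i)
    (hy : y = y₁ • 1 + y₂ • i + y₃ • j)
    (hz : z = z₁ • 1 + z₂ • i + z₃ • j + z₄ • k + z₈ • l)
    (hne : x₂ * y₃ * z₈ ≠ 0)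
    (p m n : ℝ) (a b c : Octonion) (b₁ b₂ b₃ b₄ b₅ b₆ b₇ b₈ : ℝ)
    (hb : b = b₁ • 1 + b₂ • i + b₃ • j + b₄ • k + b₅ • (k * l) + b₆ • (j * l) +
      b₇ • (i * l) + b₈ • l)
    (heig : Eig !![ofReal p, a, conj c; conj a, ofReal m, b; c, conj b, ofReal n]
      ![x, y, z] (assoc x y z)) :
    x₂ * y₃ * b₈ = 2 * y₃ * z₂ * z₈ * x₂ ^ 2 + b₆ * y₁ * x₂ - b₆ * x₁ * y₂ +
      b₇ * x₁ * y₃ := by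
  rw [generic_fst_eq] at hx
  rw [generic_snd_eq] at hy
  rw [generic_trd_eq] at hz
  rw [basis_expansion_eq] at hb
  subst hx hy hz hb
  rw [assoc_generic] at heig
  obtain ⟨a₀, a₁, a₂, a₃, a₄, a₅, a₆, a₇, rfl⟩ := a.exists_eq_ofCoords
  obtain ⟨c₀, c₁, c₂, c₃, c₄, c₅, c₆, c₇, rfl⟩ := c.exists_eq_ofCoords
  have hx := heig 0
  have hy := heig 1
  have hz := heig 2
  simp [ext_coord_iff] at hx hy hz
  obtain ⟨⟨hx₀, hx₁, hx₂, hx₃⟩, hx₄, hx₅, hx₆, hx₇⟩ := hx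
  obtain ⟨⟨hy₀, hy₁, hy₂, hy₃⟩, hy₄, hy₅, hy₆, hy₇⟩ := hy
  obtain ⟨⟨hz₀, hz₁, hz₂, hz₃⟩, hz₄, hz₅, hz₆, hz₇⟩ := hz
  obtain ⟨⟨hx_ne, hy_ne⟩, hz_ne⟩ : (x₂ ≠ 0 ∧ y₃ ≠ 0) ∧ z₈ ≠ 0 := by simpa using hne
  have hcoeff : 4 * (x₂ * y₃ * z₈) ^ 2 ≠ 0 := by positivity
  -- The eigenvalue equation forces `x`, `y`, `z` to be purely imaginary.
  obtain rfl : z₁ = 0 := by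
    refine (mul_eq_zero.mp ?_).resolve_left hcoeff
    linear_combination
      (-x₁ * x₂ * y₂ + x₂ ^ 2 * y₁) * hx₀ + (x₁ ^ 2 * y₂ - x₁ * x₂ * y₁) * hx₁ + (x₁ ^ 2 * y₃ + x₂ ^
      2 * y₃) * hx₂ + (-x₁ * y₂ ^ 2 - x₁ * y₃ ^ 2 + x₂ * y₁ * y₂) * hy₀ + (x₁ * y₁ * y₂ - x₂ * y₁ ^
      2 - x₂ * y₃ ^ 2) * hy₁ + (x₁ * y₁ * y₃ + x₂ * y₂ * y₃) * hy₂ + (-x₁ * y₂ * z₂ - x₁ * y₃ * z₃ +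
      x₂ * y₁ * z₂ + x₂ * y₃ * z₄) * hz₀ + (x₁ * y₂ * z₁ - x₁ * y₃ * z₄ - x₂ * y₁ * z₁ - x₂ * y₃ *
      z₃) * hz₁ + (x₁ * y₂ * z₄ + x₁ * y₃ * z₁ - x₂ * y₁ * z₄ + x₂ * y₃ * z₂) * hz₂ + (-x₁ * y₂ * z₃
      + x₁ * y₃ * z₂ + x₂ * y₁ * z₃ - x₂ * y₃ * z₁) * hz₃ + (-x₁ * y₂ * z₈ + x₂ * y₁ * z₈) * hz₅ +
      (-x₁ * y₃ * z₈) * hz₆ + (-x₂ * y₃ * z₈) * hz₇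
  obtain rfl : y₁ = 0 := by
    refine (mul_eq_zero.mp ?_).resolve_left hcoeff
    linear_combination
      -((-x₁ * x₂ * z₂) * hx₀ + (x₁ ^ 2 * z₂) * hx₁ + (x₁ ^ 2 * z₃ + x₂ ^ 2 * z₃) * hx₂ + (x₁ ^ 2 *
        z₄ + x₂ ^ 2 * z₄) * hx₃ + (x₁ ^ 2 * z₈ + x₂ ^ 2 * z₈) * hx₄ + (-x₁ * y₂ * z₂ - x₁ * y₃ * z₃
        - x₂ * y₃ * z₄) * hy₀ + (x₁ * y₁ * z₂ + x₁ * y₃ * z₄ - x₂ * y₃ * z₃) * hy₁ + (x₁ * y₁ * z₃ -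
        x₁ * y₂ * z₄ + x₂ * y₁ * z₄ + x₂ * y₂ * z₃) * hy₂ + (x₁ * y₁ * z₄ + x₁ * y₂ * z₃ - x₁ * y₃ *
        z₂ - x₂ * y₁ * z₃ + x₂ * y₂ * z₄) * hy₃ + (x₁ * y₁ * z₈ + x₂ * y₂ * z₈) * hy₄ + (x₁ * y₂ *
        z₈ - x₂ * y₁ * z₈) * hy₅ + (x₁ * y₃ * z₈) * hy₆ + (x₂ * y₃ * z₈) * hy₇ + (-x₁ * z₂ ^ 2 - x₁
        * z₃ ^ 2 - x₁ * z₄ ^ 2 - x₁ * z₈ ^ 2) * hz₀ + (-x₂ * z₃ ^ 2 - x₂ * z₄ ^ 2 - x₂ * z₈ ^ 2) *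
        hz₁ + (x₂ * z₂ * z₃) * hz₂ + (x₂ * z₂ * z₄) * hz₃ + (x₂ * z₂ * z₈) * hz₄)
  obtain rfl : x₁ = 0 := by
    refine (mul_eq_zero.mp ?_).resolve_left hcoeff
    linear_combination
      (x₂ * y₃ * z₄) * hx₀ + (-x₁ * y₃ * z₄) * hx₁ + (x₁ * y₂ * z₄ + x₂ * y₂ * z₃ - x₂ * y₃ * z₂) *
      hx₂ + (-x₁ * y₂ * z₃ + x₁ * y₃ * z₂ + x₂ * y₂ * z₄) * hx₃ + (x₂ * y₂ * z₈) * hx₄ + (-x₁ * y₂ *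
      z₈) * hx₅ + (-x₁ * y₃ * z₈) * hx₆ + (-x₂ * y₃ * z₈) * hx₇ + (-y₂ * y₃ * z₃ + y₃ ^ 2 * z₂) *
      hy₁ + (y₂ ^ 2 * z₃ - y₂ * y₃ * z₂) * hy₂ + (y₂ ^ 2 * z₄ + y₃ ^ 2 * z₄) * hy₃ + (y₂ ^ 2 * z₈ +
      y₃ ^ 2 * z₈) * hy₄ + (-y₂ * z₃ ^ 2 - y₂ * z₄ ^ 2 - y₂ * z₈ ^ 2 + y₃ * z₂ * z₃) * hz₁ + (y₂ *
      z₂ * z₃ - y₃ * z₂ ^ 2 - y₃ * z₄ ^ 2 - y₃ * z₈ ^ 2) * hz₂ + (y₂ * z₂ * z₄ + y₃ * z₃ * z₄) * hz₃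
      + (y₂ * z₂ * z₈ + y₃ * z₃ * z₈) * hz₄
  have hb₈ : b₈ = 2 * x₂ * z₂ * z₈ := by
    refine mul_left_cancel₀ (show 2 * y₃ * z₈ ≠ 0 by positivity) ?_
    linear_combination
      x₂ * hx₃ + (-y₃) * hy₀ + y₂ * hy₃ + (-z₃) * hz₀ + (-z₄) * hz₁ + z₂ * hz₃ + z₈ * hz₆
  rw [hb₈]
  ring
end
end

section
/- Let (x,y,z) be a generic triple of octonions, i.e. x = x₁ + x₂ i, y = y₁ + y₂ i + y₃ j, z = z₁ + z₂ i + z₃ j + z₄ k + z₈ ℓ with real coefficients, and suppose the associator λ = [x,y,z] is nonzero (equivalently x₂ y₃ z₈ ≠ 0). If some Jordan matrix A satisfies A v = v λ for v = (x,y,z)ᵀ, then v is purely imaginary: x₁ = 0, y₁ = 0, and z₁ = 0, i.e. Re(x) = Re(y) = Re(z) = 0. -/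
noncomputable section

open scoped Quaternion

namespace Octonion

/-- The real quaternion with the given coordinates. -/
def quat (a b c d : ℝ) : Quaternion ℝ := ⟨a, b, c, d⟩

@[simp] theorem quat_re (a b c d : ℝ) : (quat a b c d).re = a := rfl
@[simp] theorem quat_imI (a b c d : ℝ) : (quat a b c d).imI = b := rfl
@[simp] theorem quat_imJ (a b c d : ℝ) : (quat a b c d).imJ = c := rfl
@[simp] theorem quat_imK (a b c d : ℝ) : (quat a b c d).imK = d := rfl

@[ext]
theorem ext' {a b : Octonion} (h₁ : a.1 = b.1) (h₂ : a.2 = b.2) : a = b := Prod.ext h₁ h₂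

@[simp] theorem mul_fst_s9 (a b : Octonion) : (a * b).1 = a.1 * b.1 - star b.2 * a.2 := rfl
@[simp] theorem mul_snd_s9 (a b : Octonion) : (a * b).2 = b.2 * a.1 + a.2 * star b.1 := rfl
@[simp] theorem add_fst (a b : Octonion) : (a + b).1 = a.1 + b.1 := rfl
@[simp] theorem add_snd (a b : Octonion) : (a + b).2 = a.2 + b.2 := rfl
@[simp] theorem sub_fst (a b : Octonion) : (a - b).1 = a.1 - b.1 := rfl
@[simp] theorem sub_snd (a b : Octonion) : (a - b).2 = a.2 - b.2 := rfl
@[simp] theorem smul_fst (r : ℝ) (a : Octonion) : (r • a).1 = r • a.1 := rfl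
@[simp] theorem smul_snd (r : ℝ) (a : Octonion) : (r • a).2 = r • a.2 := rfl
@[simp] theorem conj_fst (a : Octonion) : (conj a).1 = star a.1 := rfl
@[simp] theorem conj_snd (a : Octonion) : (conj a).2 = -a.2 := rfl
@[simp] theorem one_fst : (1 : Octonion).1 = 1 := rfl
@[simp] theorem one_snd : (1 : Octonion).2 = 0 := rfl
@[simp] theorem i_fst : i.1 = quat 0 1 0 0 := rfl
@[simp] theorem i_snd : i.2 = 0 := rfl
@[simp] theorem j_fst : j.1 = quat 0 0 1 0 := rfl
@[simp] theorem j_snd : j.2 = 0 := rfl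
@[simp] theorem k_fst : k.1 = quat 0 0 0 1 := rfl
@[simp] theorem k_snd : k.2 = 0 := rfl
@[simp] theorem l_fst : l.1 = 0 := rfl
@[simp] theorem l_snd : l.2 = 1 := rfl

@[simp]
theorem conj_conj (a : Octonion) : conj (conj a) = a := by
  ext1 <;> simp

theorem mul_sub (a b c : Octonion) : a * (b - c) = a * b - a * c := by
  ext : 2 <;> simp <;> ring

theorem mul_mul_conj (a b : Octonion) : a * b * conj b = normSq b • a := by
  ext : 2 <;> simp [normSq, Quaternion.normSq_def'] <;> ring

theorem self_mul_conj_mul (a b : Octonion) : a * conj a * b = normSq a • b := by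
  ext : 2 <;> simp [normSq, Quaternion.normSq_def'] <;> ring

theorem smul_mul (r : ℝ) (a b : Octonion) : (r • a) * b = r • (a * b) := by
  ext : 2 <;> simp <;> ring

theorem mul_smul (r : ℝ) (a b : Octonion) : a * (r • b) = r • (a * b) := by
  ext : 2 <;> simp <;> ring

set_option maxHeartbeats 1000000 in
/-- The right Moufang identity. -/
theorem mul_mul_mul_self (a b c : Octonion) : a * b * c * b = a * (b * c * b) := by
  ext : 2 <;> simp <;> ring

/-- A self-conjugate octonion is real, so it acts by a scalar. -/
theorem mul_of_conj_eq {a : Octonion} (ha : conj a = a) (b : Octonion) : a * b = re a • b := by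
  have h1 := congrArg Prod.fst ha
  have h2 := congrArg Prod.snd ha
  have h3 : a.2 = 0 := by
    have h : (2 : ℝ) • a.2 = 0 := by
      rw [two_smul]
      nth_rewrite 1 [← h2]
      exact neg_add_cancel a.2
    exact (smul_eq_zero.mp h).resolve_left two_ne_zero
  have h4 : a.1 = (a.1.re : Quaternion ℝ) := Quaternion.star_eq_self.mp h1
  ext1
  · rw [mul_fst_s9, h3, h4, mul_zero, sub_zero, Quaternion.coe_mul_eq_smul]; rfl
  · rw [mul_snd_s9, h3, h4, zero_mul, add_zero, Quaternion.mul_coe_eq_smul]; rfl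

/-- The Euclidean inner product on the octonions. -/
def inner (a b : Octonion) : ℝ := re (conj a * b)

theorem inner_comm (a b : Octonion) : inner a b = inner b a := by
  simp [inner, re]; ring

theorem inner_add (a b c : Octonion) : inner a (b + c) = inner a b + inner a c := by
  simp [inner, re]; ring

theorem inner_smul (r : ℝ) (a b : Octonion) : inner a (r • b) = r * inner a b := by
  simp [inner, re]; ring

theorem inner_sub (a b c : Octonion) : inner a (b - c) = inner a b - inner a c := by
  simp [inner, re]; ring

theorem sub_inner (a b c : Octonion) : inner (a - b) c = inner a c - inner b c := by
  simp [inner, re]; ring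

theorem inner_mul_left (a b c : Octonion) : inner a (b * c) = inner (conj b * a) c := by
  simp [inner, re]; ring

theorem mul_inner (a b c : Octonion) : inner (a * b) c = inner a (c * conj b) := by
  simp [inner, re]; ring

/-- Right multiplication by `conj x * y - conj y * x`, performed one factor at a time. -/
def commMul (x y v : Octonion) : Octonion := v * conj x * y - v * conj y * x

theorem inner_commMul_self (x y z : Octonion) : inner (commMul x y z) z = 0 := by
  simp only [commMul, sub_inner, mul_inner (z * _), mul_inner z, conj_conj]
  rw [inner_comm z, mul_inner, mul_inner, conj_conj, sub_self]

theorem inner_commMul_mul_self (x y z : Octonion) {a : Octonion} (ha : conj a = a) :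
    inner (commMul x y z) (a * z) = 0 := by
  rw [mul_of_conj_eq ha, inner_smul, inner_commMul_self, mul_zero]

theorem inner_commMul_swap (x y z w : Octonion) :
    inner (commMul y x z) w = -inner (commMul x y z) w := by
  simp only [commMul, sub_inner, neg_sub]

theorem inner_commMul_left (x y z a : Octonion) :
    inner (commMul x y x) (a * z) + inner (commMul x y z) (conj a * x) = 0 := by
  have h : conj a * commMul x y x = conj a * x * conj x * y - conj a * x * conj y * x := by
    rw [commMul, mul_sub, self_mul_conj_mul, mul_mul_mul_self, mul_mul_conj, mul_smul,
      smul_mul]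
  have h' : inner (commMul x y z) (conj a * x) =
      -inner z (conj a * x * conj x * y - conj a * x * conj y * x) := by
    simp only [commMul, sub_inner, mul_inner, conj_conj, inner_sub, neg_sub]
  rw [inner_mul_left, h, h', inner_comm, add_neg_cancel]

theorem inner_commMul_right (x y z a : Octonion) :
    inner (commMul x y y) (a * z) + inner (commMul x y z) (conj a * y) = 0 := by
  have h := inner_commMul_left y x z a
  rw [inner_commMul_swap x y, inner_commMul_swap x y] at h
  linarith

/-- The linear constraint that a Hermitian eigenvector equation puts on the right-hand side. -/
theorem sum_inner_commMul_eq_zero {x y z d₀ d₁ d₂ a b c lam : Octonion}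
    (hd₀ : conj d₀ = d₀) (hd₁ : conj d₁ = d₁) (hd₂ : conj d₂ = d₂)
    (h₀ : d₀ * x + a * y + b * z = x * lam)
    (h₁ : conj a * x + d₁ * y + c * z = y * lam)
    (h₂ : conj b * x + conj c * y + d₂ * z = z * lam) :
    inner (commMul x y x) (x * lam) + inner (commMul x y y) (y * lam) +
      inner (commMul x y z) (z * lam) = 0 := by
  rw [← h₀, ← h₁, ← h₂]
  simp only [inner_add]
  linarith [inner_commMul_mul_self x y x hd₀, inner_commMul_mul_self x y y hd₁,
    inner_commMul_mul_self x y z hd₂, inner_commMul_left x y y a, inner_commMul_left x y z b,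
    inner_commMul_right x y z c]

end Octonion

open Octonion in
/-- For a generic triple with nonzero associator `λ = [x,y,z]`, if some Jordan matrix
admits `v = (x,y,z)ᵀ` as an eigenvector with eigenvalue `λ`, then `v` is purely
imaginary: `x₁ = y₁ = z₁ = 0`. -/
theorem eigenvector_purely_imaginary (x y z : Octonion)
    (x₁ x₂ y₁ y₂ y₃ z₁ z₂ z₃ z₄ z₈ : ℝ)
    (hx : x = x₁ • 1 + x₂ • i)
    (hy : y = y₁ • 1 + y₂ • i + y₃ • j)
    (hz : z = z₁ • 1 + z₂ • i + z₃ • j + z₄ • k + z₈ • l)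
    (hne : x₂ * y₃ * z₈ ≠ 0)
    (hA : ∃ A : Matrix (Fin 3) (Fin 3) Octonion,
      IsHermitian A ∧ Eig A ![x, y, z] (assoc x y z)) :
    x₁ = 0 ∧ y₁ = 0 ∧ z₁ = 0 := by
  obtain ⟨A, hH, hE⟩ := hA
  have h₀ := hE 0
  have h₁ := hE 1
  have h₂ := hE 2
  simp only [Matrix.cons_val] at h₀ h₁ h₂
  rw [← hH 1 0] at h₁
  rw [← hH 2 0, ← hH 2 1] at h₂
  have hxy := sum_inner_commMul_eq_zero (hH 0 0) (hH 1 1) (hH 2 2) h₀ h₁ h₂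
  have hxz := sum_inner_commMul_eq_zero (x := x) (y := z) (z := y) (a := A 0 2) (b := A 0 1)
    (c := conj (A 1 2)) (lam := assoc x y z) (hH 0 0) (hH 2 2) (hH 1 1)
    (by rw [← h₀]; abel) (by rw [← h₂]; abel) (by rw [← h₁, conj_conj]; abel)
  have hyz := sum_inner_commMul_eq_zero (x := y) (y := z) (z := x) (a := A 1 2)
    (b := conj (A 0 1)) (c := conj (A 0 2)) (lam := assoc x y z) (hH 1 1) (hH 2 2) (hH 0 0)
    (by rw [← h₁]; abel) (by rw [← h₂]; abel) (by rw [← h₀, conj_conj, conj_conj]; abel)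
  have hx2 : x.2 = 0 := by simp [hx]
  have hy2 : y.2 = 0 := by simp [hy]
  have hz2 : z.2 = quat z₈ 0 0 0 := by apply Quaternion.ext <;> simp [hz]
  have hx1 : x.1 = quat x₁ x₂ 0 0 := by apply Quaternion.ext <;> simp [hx]
  have hy1 : y.1 = quat y₁ y₂ y₃ 0 := by apply Quaternion.ext <;> simp [hy]
  have hz1 : z.1 = quat z₁ z₂ z₃ z₄ := by apply Quaternion.ext <;> simp [hz]
  have hlam1 : (assoc x y z).1 = 0 := by
    apply Quaternion.ext <;> simp [assoc, hx1, hx2, hy1, hy2, hz1, hz2] <;> ring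
  have hlam2 : (assoc x y z).2 = quat 0 0 0 (2 * (x₂ * y₃ * z₈)) := by
    apply Quaternion.ext <;> simp [assoc, hx1, hx2, hy1, hy2, hz1, hz2] <;> ring
  have hz₁ : 8 * (x₂ * y₃ * z₈) ^ 2 * z₁ = 0 := by
    rw [← neg_eq_zero, ← hxy]
    simp [Octonion.inner, commMul, re, hx1, hx2, hy1, hy2, hz1, hz2, hlam1, hlam2]
    ring
  have hy₁ : 8 * (x₂ * y₃ * z₈) ^ 2 * y₁ = 0 := by
    rw [← hxz]
    simp [Octonion.inner, commMul, re, hx1, hx2, hy1, hy2, hz1, hz2, hlam1, hlam2]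
    ring
  have hx₁ : 8 * (x₂ * y₃ * z₈) ^ 2 * x₁ = 0 := by
    rw [← neg_eq_zero, ← hyz]
    simp [Octonion.inner, commMul, re, hx1, hx2, hy1, hy2, hz1, hz2, hlam1, hlam2]
    ring
  have h : 8 * (x₂ * y₃ * z₈) ^ 2 ≠ 0 := by positivity
  exact ⟨(mul_eq_zero.mp hx₁).resolve_left h, (mul_eq_zero.mp hy₁).resolve_left h,
    (mul_eq_zero.mp hz₁).resolve_left h⟩
end
end
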